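/- arXiv:2007.02331 — 2 statements merged into one kernel-verified Lean document; each statement's English description precedes it below -/
import Mathlib

section
/- Let n ≥ 3. There exists a constant C > 0 such that for every (τ,ξ) ∈ ℝ×ℝⁿ with τ² + |ξ|² = 1 and |τ| < |ξ|/2, there exist unit vectors ω¹,…,ωⁿ ∈ ℝⁿ with ωᵏ·ξ = τ for each k ∈ {1,…,n}, such that every vector a = (a₀,a₁,…,a_n) ∈ ℂ^{n+1} satisfying the divergence-free constraint τ a₀ + Σ_{j=1}^n ξ_j a_j = 0 obeys max_{0 ≤ j ≤ n} |a_j| ≤ C · max_{1 ≤ k ≤ n} | a₀ − ωᵏ·(a₁,…,a_n) |. The constant C is independent of (τ,ξ). -/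
open scoped RealInnerProductSpace

/-- The real-linear functional `v ↦ Σ vᵢ cᵢ`. -/
noncomputable def pairL {n : ℕ} (c : Fin n → ℂ) : EuclideanSpace ℝ (Fin n) →ₗ[ℝ] ℂ where
  toFun v := ∑ i, ((v i : ℝ) : ℂ) * c i
  map_add' x y := by
    simp [add_mul, Finset.sum_add_distrib]
  map_smul' r x := by
    simp [Finset.mul_sum, mul_assoc]

theorem exists_basis_first {n : ℕ} (i0 : Fin n) (e : EuclideanSpace ℝ (Fin n)) (he : ‖e‖ = 1) :
    ∃ b : OrthonormalBasis (Fin n) ℝ (EuclideanSpace ℝ (Fin n)), b i0 = e := by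
  have h : Orthonormal ℝ (({i0} : Set (Fin n)).domRestrict (fun _ => e)) := by
    rw [orthonormal_iff_ite]
    rintro ⟨i, hi⟩ ⟨j, hj⟩
    simp only [Set.mem_singleton_iff] at hi hj
    subst hi; subst hj
    simp [Set.domRestrict, he]
  obtain ⟨b, hb⟩ := h.exists_orthonormalBasis_extension_of_card_eq (by simp)
  exact ⟨b, hb i0 rfl⟩

/-- **Lemma 4 of the paper**: uniform stable solvability of the system
`(1,−ωᵏ)·a = Gᵏ`, `(τ,ξ)·a = 0` for divergence-free Fourier coefficient vectors:
there is a constant `C`, independent of `(τ,ξ)` in the unit sphere with `|τ| < |ξ|/2`,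
and unit vectors `ω¹,…,ωⁿ` with `ωᵏ·ξ = τ`, such that every `a ∈ ℂ^{n+1}` with
`τa₀ + Σ ξⱼaⱼ = 0` satisfies `max|aⱼ| ≤ C maxₖ |a₀ − ωᵏ·(a₁,…,aₙ)|`. -/
theorem divergence_free_stable_inversion
    (n : ℕ) (hn : 3 ≤ n) :
    ∃ C > 0,
      ∀ (τ : ℝ) (ξ : EuclideanSpace ℝ (Fin n)),
        τ ^ 2 + ‖ξ‖ ^ 2 = 1 → |τ| < ‖ξ‖ / 2 →
        ∃ ω : Fin n → EuclideanSpace ℝ (Fin n),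
          (∀ k, ‖ω k‖ = 1 ∧ ⟪ω k, ξ⟫ = τ) ∧
          ∀ a : Fin (n + 1) → ℂ,
            (τ : ℂ) * a 0 + ∑ j : Fin n, (ξ j : ℂ) * a j.succ = 0 →
            ∀ j : Fin (n + 1),
              ‖a j‖ ≤ C * ⨆ k : Fin n, ‖a 0 - ∑ i : Fin n, ((ω k) i : ℂ) * a i.succ‖ := by
  have hn0 : 0 < n := by omega
  have hnR : (0 : ℝ) < n := by exact_mod_cast hn0
  refine ⟨4 * n, by positivity, ?_⟩
  intro τ ξ h1 h2
  have hr : 0 < ‖ξ‖ := by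
    have := abs_nonneg τ
    linarith
  obtain ⟨b, hb⟩ := exists_basis_first (⟨0, hn0⟩ : Fin n) (‖ξ‖⁻¹ • ξ) (by
    rw [norm_smul, norm_inv, norm_norm, inv_mul_cancel₀ hr.ne'])
  set i0 : Fin n := ⟨0, hn0⟩ with hi0
  set i1 : Fin n := ⟨1, by omega⟩ with hi1
  have h01 : i0 ≠ i1 := by simp [hi0, hi1]
  set r := ‖ξ‖ with hrdef
  have hξ : ξ = r • b i0 := by
    rw [hb, smul_smul, mul_inv_cancel₀ hr.ne', one_smul]
  obtain ⟨t, ht⟩ : ∃ t, t = τ / r := ⟨_, rfl⟩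
  have htr : t * r = τ := by rw [ht]; field_simp
  have htabs : |t| < 1 / 2 := by
    rw [ht, abs_div, abs_of_pos hr, div_lt_iff₀ hr]; linarith
  have ht2 : t ^ 2 < 1 / 4 := by
    rw [← sq_abs]; nlinarith [abs_nonneg t]
  obtain ⟨s, hs, hs2⟩ : ∃ s : ℝ, 1 / 2 ≤ s ∧ s ^ 2 = 1 - t ^ 2 := by
    refine ⟨√(1 - t ^ 2), ?_, Real.sq_sqrt (by linarith)⟩
    apply Real.le_sqrt_of_sq_le
    norm_num
    linarith
  have hbo : ∀ i j, ⟪b i, b j⟫ = if i = j then (1 : ℝ) else 0 :=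
    orthonormal_iff_ite.mp b.orthonormal
  have key : ∀ (k : Fin n) (σ : ℝ), i0 ≠ k → σ ^ 2 = 1 - t ^ 2 →
      ‖t • b i0 + σ • b k‖ = 1 ∧ ⟪t • b i0 + σ • b k, ξ⟫ = τ := by
    intro k σ hk hσ
    constructor
    · have : ‖t • b i0 + σ • b k‖ ^ 2 = 1 := by
        rw [← real_inner_self_eq_norm_sq]
        simp only [inner_add_left, inner_add_right, inner_smul_left, inner_smul_right, hbo]
        simp [hk, hk.symm]
        nlinarith
      have h0 := norm_nonneg (t • b i0 + σ • b k)
      nlinarith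
    · rw [hξ]
      simp only [inner_add_left, inner_smul_left, inner_smul_right, hbo]
      simp [hk.symm]
      linarith
  refine ⟨fun k => if k = i0 then t • b i0 + (-s) • b i1 else t • b i0 + s • b k, ?_, ?_⟩
  · intro k
    by_cases hk : k = i0
    · simp only [hk, if_true]
      exact key i1 (-s) h01 (by rw [neg_sq, hs2])
    · simp only [hk, if_false]
      exact key k s (Ne.symm hk) hs2
  intro a ha
  set ω : Fin n → EuclideanSpace ℝ (Fin n) :=
    fun k => if k = i0 then t • b i0 + (-s) • b i1 else t • b i0 + s • b k with hω
  set L := pairL (fun i : Fin n => a i.succ) with hL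
  have hLdef : ∀ v : EuclideanSpace ℝ (Fin n), ∑ i, ((v i : ℝ) : ℂ) * a i.succ = L v :=
    fun v => rfl
  simp only [hLdef] at ha ⊢
  set M := ⨆ k : Fin n, ‖a 0 - L (ω k)‖ with hM
  have hMk : ∀ k, ‖a 0 - L (ω k)‖ ≤ M := fun k =>
    le_ciSup (f := fun k => ‖a 0 - L (ω k)‖) (Set.finite_range _).bddAbove k
  have hM0 : 0 ≤ M := (norm_nonneg _).trans (hMk i0)
  have hL0 : L (b i0) = -(t : ℂ) * a 0 := by
    rw [hξ, map_smul, ← htr] at ha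
    have hrc : (r : ℂ) ≠ 0 := by exact_mod_cast hr.ne'
    apply mul_left_cancel₀ hrc
    rw [Complex.real_smul] at ha
    push_cast at ha
    linear_combination ha
  have hg : ∀ k, k ≠ i0 → a 0 - L (ω k) = ((1 + t ^ 2 : ℝ) : ℂ) * a 0 - (s : ℂ) * L (b k) := by
    intro k hk
    simp only [hω, hk, if_false, map_add, map_smul, Complex.real_smul, hL0]
    push_cast; ring
  have hg0 : a 0 - L (ω i0) = ((1 + t ^ 2 : ℝ) : ℂ) * a 0 + (s : ℂ) * L (b i1) := by
    simp only [hω, if_true, map_add, map_smul, Complex.real_smul, hL0]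
    push_cast; ring
  have hX : ‖((1 + t ^ 2 : ℝ) : ℂ) * a 0‖ ≤ M := by
    have e : (2 : ℂ) * (((1 + t ^ 2 : ℝ) : ℂ) * a 0) = (a 0 - L (ω i0)) + (a 0 - L (ω i1)) := by
      rw [hg0, hg i1 h01.symm]; ring
    have e2 := norm_add_le (a 0 - L (ω i0)) (a 0 - L (ω i1))
    rw [← e, norm_mul, Complex.norm_ofNat] at e2
    linarith [hMk i0, hMk i1]
  have ha0 : ‖a 0‖ ≤ M := by
    rw [norm_mul, Complex.norm_real, Real.norm_eq_abs, abs_of_pos (by positivity)] at hX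
    nlinarith [norm_nonneg (a 0), sq_nonneg t, mul_nonneg (sq_nonneg t) (norm_nonneg (a 0))]
  have hA : ∀ k, ‖L (b k)‖ ≤ 4 * M := by
    intro k
    by_cases hk : k = i0
    · rw [hk, hL0, norm_mul, norm_neg, Complex.norm_real, Real.norm_eq_abs]
      nlinarith [norm_nonneg (a 0), abs_nonneg t]
    · have e : (s : ℂ) * L (b k) = ((1 + t ^ 2 : ℝ) : ℂ) * a 0 - (a 0 - L (ω k)) := by
        rw [hg k hk]; ring
      have e2 := norm_sub_le (((1 + t ^ 2 : ℝ) : ℂ) * a 0) (a 0 - L (ω k))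
      rw [← e, norm_mul, Complex.norm_real, Real.norm_eq_abs, abs_of_pos (by linarith)] at e2
      have := hMk k
      nlinarith [norm_nonneg (L (b k))]
  have hn1 : (1 : ℝ) ≤ n := by exact_mod_cast hn0
  intro j
  refine Fin.cases ?_ (fun j => ?_) j
  · nlinarith
  · have e1 : a j.succ = L (EuclideanSpace.single j (1 : ℝ)) := by
      rw [← hLdef]
      simp [apply_ite (fun x : ℝ => (x : ℂ)), ite_mul]
    rw [e1, ← b.sum_repr' (EuclideanSpace.single j (1 : ℝ)), map_sum]
    calc _ ≤ ∑ k : Fin n, 4 * M := by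
          apply norm_sum_le_of_le
          intro k _
          rw [map_smul, norm_smul]
          have h3 := norm_inner_le_norm (𝕜 := ℝ) (b k) (EuclideanSpace.single j (1 : ℝ))
          rw [b.orthonormal.1 k] at h3
          simp only [EuclideanSpace.norm_single, norm_one, mul_one] at h3
          calc _ ≤ 1 * ‖L (b k)‖ := mul_le_mul_of_nonneg_right h3 (norm_nonneg _)
            _ ≤ _ := by rw [one_mul]; exact hA k
      _ = 4 * n * M := by
          simp; ring
end

section
/- Let n ≥ 3, let ω₀ ∈ ℝⁿ be a unit vector and let 0 < ε ≤ 1. Then there exist a nonempty open set C₀ ⊆ ℝ^{n+1} that is a cone (i.e. (τ,ξ) ∈ C₀ and r > 0 imply (rτ, rξ) ∈ C₀) with C₀ ⊆ { (τ,ξ) ∈ ℝ×ℝⁿ : ξ ≠ 0 and |τ| < (ε/8)|ξ| }, and a constant C > 0, such that for every (τ,ξ) ∈ C₀ and every a = (a₀,a₁,…,a_n) ∈ ℂ^{n+1} with τ a₀ + Σ_{j=1}^n ξ_j a_j = 0, one has max_{0 ≤ j ≤ n} |a_j| ≤ C · sup { | a₀ − ω·(a₁,…,a_n) | : ω ∈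 ℝⁿ, |ω| = 1, ω·ξ = τ, |ω − ω₀| < ε }. -/
open scoped RealInnerProductSpace

lemma cone_aux_exists_unit_orth (n : ℕ) (hn : 3 ≤ n) (x y : EuclideanSpace ℝ (Fin n)) :
    ∃ f : EuclideanSpace ℝ (Fin n), ‖f‖ = 1 ∧ ⟪f, x⟫ = 0 ∧ ⟪f, y⟫ = 0 := by
  classical
  set K : Submodule ℝ (EuclideanSpace ℝ (Fin n)) := Submodule.span ℝ ({x, y} : Set _) with hK
  have h1 : Module.finrank ℝ K ≤ 2 := by
    have h := finrank_span_finset_le_card (R := ℝ) ({x, y} : Finset (EuclideanSpace ℝ (Fin n)))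
    have h2 : ({x, y} : Finset (EuclideanSpace ℝ (Fin n))).card ≤ 2 := Finset.card_le_two
    have h3 : Module.finrank ℝ K ≤ ({x, y} : Finset (EuclideanSpace ℝ (Fin n))).card := by
      have hset : ((({x, y} : Finset (EuclideanSpace ℝ (Fin n)))) : Set _) = {x, y} := by simp
      rw [Set.finrank, hset] at h
      exact h
    omega
  have h2 := Submodule.finrank_add_finrank_orthogonal K
  have h3 : 0 < Module.finrank ℝ Kᗮ := by
    rw [finrank_euclideanSpace_fin] at h2
    omega
  have : Nontrivial Kᗮ := Module.finrank_pos_iff.mp h3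
  obtain ⟨g, hg⟩ := exists_ne (0 : Kᗮ)
  have hg0 : (g : EuclideanSpace ℝ (Fin n)) ≠ 0 := by simpa using hg
  have hx : ⟪(g : EuclideanSpace ℝ (Fin n)), x⟫ = 0 :=
    Submodule.inner_left_of_mem_orthogonal (Submodule.subset_span (by simp)) g.2
  have hy : ⟪(g : EuclideanSpace ℝ (Fin n)), y⟫ = 0 :=
    Submodule.inner_left_of_mem_orthogonal (Submodule.subset_span (by simp)) g.2
  refine ⟨(‖(g : EuclideanSpace ℝ (Fin n))‖)⁻¹ • (g : EuclideanSpace ℝ (Fin n)), ?_, ?_, ?_⟩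
  · exact norm_smul_inv_norm (𝕜 := ℝ) hg0
  · rw [real_inner_smul_left, hx, mul_zero]
  · rw [real_inner_smul_left, hy, mul_zero]

lemma cone_aux_num (ε ρ c σ : ℝ) (hε0 : 0 < ε) (hε1 : ε ≤ 1)
    (hρ : 1 - (ε / 8) ^ 2 ≤ ρ) (hσ : 1 - (ε / 8) ^ 2 ≤ σ) (hc : 1 - ε ^ 2 / 8 ≤ c) :
    1 - ε ^ 2 / 8 - 2 * (ε / 8) ^ 2 ≤ ρ * c * σ := by
  have hq : (ε / 8) ^ 2 = ε ^ 2 / 64 := by ring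
  have hε2 : ε ^ 2 ≤ 1 := by nlinarith
  have hε3 : 0 ≤ ε ^ 2 := sq_nonneg ε
  rw [hq] at hρ hσ ⊢
  generalize ε ^ 2 = q at *
  have h5 : (1 - q / 64) * (1 - q / 8) ≤ ρ * c :=
    mul_le_mul hρ hc (by linarith) (by linarith)
  have h50 : 1 - q / 64 - q / 8 ≤ (1 - q / 64) * (1 - q / 8) := by nlinarith
  have h6 : (1 - q / 64 - q / 8) * (1 - q / 64) ≤ ρ * c * σ :=
    mul_le_mul (h50.trans h5) hσ (by linarith) (by linarith)
  nlinarith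

lemma cone_aux_mul_le {x y B : ℝ} (hx : x ≤ 1) (hy : 0 ≤ y) (hB : y ≤ B) : x * y ≤ B :=
  (mul_le_of_le_one_left hy hx).trans hB

section aux
variable {V : Type*} [NormedAddCommGroup V] [InnerProductSpace ℝ V]

/-- The explicit test vectors lie in the cap. -/
lemma cone_aux_mem (ω₀ ξ e f : V) (ε τ ρ σ c s : ℝ)
    (hω₀ : ‖ω₀‖ = 1) (hε0 : 0 < ε) (hε1 : ε ≤ 1)
    (hξ : ‖ξ‖ = 1) (he : ‖e‖ = 1) (hf : ‖f‖ = 1)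
    (heξ : ⟪e, ξ⟫ = 0) (hfξ : ⟪f, ξ⟫ = 0) (hfe : ⟪f, e⟫ = 0)
    (hdec : ω₀ = ⟪ω₀, ξ⟫ • ξ + σ • e)
    (hτ : |τ| < ε / 8) (hω : |⟪ω₀, ξ⟫| < ε / 8)
    (hρ : 1 - (ε / 8) ^ 2 ≤ ρ) (hρ2 : ρ ^ 2 + τ ^ 2 = 1)
    (hσ : 1 - (ε / 8) ^ 2 ≤ σ)
    (hc : 1 - ε ^ 2 / 8 ≤ c) (hcs : c ^ 2 + s ^ 2 = 1) :
    ‖τ • ξ + ρ • (c • e + s • f)‖ = 1 ∧ ⟪τ • ξ + ρ • (c • e + s • f), ξ⟫ = τ ∧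
      ‖τ • ξ + ρ • (c • e + s • f) - ω₀‖ < ε := by
  have hξξ : ⟪ξ, ξ⟫ = 1 := by rw [real_inner_self_eq_norm_sq, hξ]; norm_num
  have hee : ⟪e, e⟫ = 1 := by rw [real_inner_self_eq_norm_sq, he]; norm_num
  have hff : ⟪f, f⟫ = 1 := by rw [real_inner_self_eq_norm_sq, hf]; norm_num
  have hξe : ⟪ξ, e⟫ = 0 := by rw [real_inner_comm]; exact heξ
  have hξf : ⟪ξ, f⟫ = 0 := by rw [real_inner_comm]; exact hfξ
  have hef : ⟪e, f⟫ = 0 := by rw [real_inner_comm]; exact hfe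
  generalize hκ : ⟪ω₀, ξ⟫ = κ at *
  have h1 : ‖τ • ξ + ρ • (c • e + s • f)‖ = 1 := by
    have : ‖τ • ξ + ρ • (c • e + s • f)‖ ^ 2 = 1 := by
      rw [← real_inner_self_eq_norm_sq]
      simp only [inner_add_left, inner_add_right, real_inner_smul_left, real_inner_smul_right,
        hξξ, hee, hff, hξe, heξ, hξf, hfξ, hef, hfe]
      linear_combination ρ ^ 2 * hcs + hρ2
    exact (pow_eq_one_iff_of_nonneg (norm_nonneg _) two_ne_zero).mp this
  refine ⟨h1, ?_, ?_⟩
  · simp only [inner_add_left, real_inner_smul_left, hξξ, heξ, hfξ]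
    ring
  · have h2 : ⟪τ • ξ + ρ • (c • e + s • f), ω₀⟫ = τ * κ + ρ * c * σ := by
      rw [hdec]
      simp only [inner_add_left, inner_add_right, real_inner_smul_left, real_inner_smul_right,
        hξξ, hee, hff, hξe, heξ, hξf, hfξ, hef, hfe]
      ring
    have h3 := norm_sub_sq_real (τ • ξ + ρ • (c • e + s • f)) ω₀
    rw [h1, h2, hω₀] at h3
    have h4 : -(ε / 8) ^ 2 ≤ τ * κ := by
      have : |τ * κ| ≤ (ε / 8) * (ε / 8) := by
        rw [abs_mul]
        exact mul_le_mul hτ.le hω.le (abs_nonneg _) (by positivity)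
      have := neg_abs_le (τ * κ)
      nlinarith
    have h7 := cone_aux_num ε ρ c σ hε0 hε1 hρ hσ hc
    have h8 : ‖τ • ξ + ρ • (c • e + s • f) - ω₀‖ ^ 2 < ε ^ 2 := by
      have : 0 < ε ^ 2 := by positivity
      have hq : (ε / 8) ^ 2 = ε ^ 2 / 64 := by ring
      rw [hq] at h4 h7
      linarith
    exact lt_of_pow_lt_pow_left₀ 2 hε0.le h8

set_option maxHeartbeats 1000000 in
lemma cone_aux_main (hV : ∀ x y : V, ∃ f : V, ‖f‖ = 1 ∧ ⟪f, x⟫ = 0 ∧ ⟪f, y⟫ = 0)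
    (L : V →ₗ[ℝ] ℂ) (a₀ : ℂ) (ω₀ ξ : V) (ε τ S : ℝ)
    (hω₀ : ‖ω₀‖ = 1) (hε0 : 0 < ε) (hε1 : ε ≤ 1)
    (hξ : ‖ξ‖ = 1) (hτ : |τ| < ε / 8) (hω : |⟪ω₀, ξ⟫| < ε / 8)
    (hL : (τ : ℂ) * a₀ + L ξ = 0)
    (hS : ∀ ω : V, ‖ω‖ = 1 → ⟪ω, ξ⟫ = τ → ‖ω - ω₀‖ < ε → ‖a₀ - L ω‖ ≤ S) :
    ‖a₀‖ ≤ (1 + 80 / ε ^ 2) * S ∧ ∀ u : V, ‖u‖ = 1 → ‖L u‖ ≤ (1 + 80 / ε ^ 2) * S := by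
  have hξξ : ⟪ξ, ξ⟫ = 1 := by rw [real_inner_self_eq_norm_sq, hξ]; norm_num
  have hε2 : ε ^ 2 ≤ 1 := by nlinarith
  have hε2' : 0 < ε ^ 2 := by positivity
  obtain ⟨κ, hκ⟩ : ∃ κ, ⟪ω₀, ξ⟫ = κ := ⟨_, rfl⟩
  have hκ2 : κ ^ 2 ≤ (ε / 8) ^ 2 := by
    rw [hκ] at hω
    exact sq_le_sq' (by linarith [neg_abs_le κ]) (by linarith [le_abs_self κ])
  have hτ2 : τ ^ 2 ≤ (ε / 8) ^ 2 :=
    sq_le_sq' (by linarith [neg_abs_le τ]) (by linarith [le_abs_self τ])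
  -- general square root fact
  have hsq : ∀ x : ℝ, x ^ 2 ≤ (ε / 8) ^ 2 → ∃ r : ℝ, 1 - (ε / 8) ^ 2 ≤ r ∧ r ^ 2 + x ^ 2 = 1 := by
    intro x hx
    have h0 : 0 ≤ 1 - x ^ 2 := by nlinarith
    refine ⟨√(1 - x ^ 2), ?_, ?_⟩
    · apply Real.le_sqrt_of_sq_le
      nlinarith [sq_nonneg x, sq_nonneg ε]
    · rw [Real.sq_sqrt h0]; ring
  obtain ⟨ρ, hρ, hρ2⟩ := hsq τ hτ2
  obtain ⟨σ, hσ, hσ2⟩ := hsq κ hκ2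
  have hq64 : (ε / 8) ^ 2 = ε ^ 2 / 64 := by ring
  have hρhalf : 1 / 2 ≤ ρ := by rw [hq64] at hρ; linarith
  have hσpos : 0 < σ := by rw [hq64] at hσ; linarith
  obtain ⟨v, hv⟩ : ∃ v, v = ω₀ - κ • ξ := ⟨_, rfl⟩
  have hvξ : ⟪v, ξ⟫ = 0 := by
    rw [hv, inner_sub_left, real_inner_smul_left, hκ, hξξ]; ring
  have hvn : ‖v‖ = σ := by
    have : ‖v‖ ^ 2 = σ ^ 2 := by
      rw [hv, norm_sub_sq_real, real_inner_smul_right, hκ, norm_smul, hξ, hω₀, mul_one,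
        Real.norm_eq_abs, sq_abs]
      linarith
    exact (pow_left_inj₀ (norm_nonneg _) hσpos.le two_ne_zero).mp this
  obtain ⟨e, hedef⟩ : ∃ e, e = σ⁻¹ • v := ⟨_, rfl⟩
  have he : ‖e‖ = 1 := by
    rw [hedef, norm_smul, hvn, Real.norm_eq_abs, abs_of_pos (by positivity)]
    field_simp
  have hee : ⟪e, e⟫ = 1 := by rw [real_inner_self_eq_norm_sq, he]; norm_num
  have heξ : ⟪e, ξ⟫ = 0 := by rw [hedef, real_inner_smul_left, hvξ, mul_zero]
  have hdec : ω₀ = ⟪ω₀, ξ⟫ • ξ + σ • e := by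
    rw [hκ, hedef, smul_smul, mul_inv_cancel₀ hσpos.ne', one_smul, hv]; abel
  obtain ⟨s, hs⟩ : ∃ s, s = √(1 - (1 - ε ^ 2 / 8) ^ 2) := ⟨_, rfl⟩
  have hs2 : s ^ 2 = 1 - (1 - ε ^ 2 / 8) ^ 2 := by
    rw [hs, Real.sq_sqrt]; nlinarith
  have hsη : ε ^ 2 / 8 ≤ s := by
    rw [hs]; apply Real.le_sqrt_of_sq_le; nlinarith
  obtain ⟨c, hc⟩ : ∃ c, c = 1 - ε ^ 2 / 8 := ⟨_, rfl⟩
  have hpt : ∀ f : V, ‖f‖ = 1 → ⟪f, ξ⟫ = 0 → ⟪f, e⟫ = 0 → ∀ c' s' : ℝ, 1 - ε ^ 2 / 8 ≤ c' →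
      c' ^ 2 + s' ^ 2 = 1 →
      ‖a₀ - (τ * L ξ + ρ * (c' * L e + s' * L f))‖ ≤ S := by
    intro f hf hfξ hfe c' s' hc' hcs
    obtain ⟨h1, h2, h3⟩ := cone_aux_mem ω₀ ξ e f ε τ ρ σ c' s' hω₀ hε0 hε1 hξ he hf heξ hfξ hfe
      hdec hτ hω hρ hρ2 hσ hc' hcs
    have h := hS _ h1 h2 h3
    simpa only [map_add, map_smul, Complex.real_smul] using h
  obtain ⟨T, hT⟩ : ∃ T, T = S / ε ^ 2 := ⟨_, rfl⟩
  have hTS : S = ε ^ 2 * T := by rw [hT]; field_simp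
  have hgoal : (1 + 80 / ε ^ 2) * S = S + 80 * T := by rw [hT]; ring
  have hs0 : 0 ≤ s := le_trans (by positivity) hsη
  have h2s' : ε ^ 2 / 8 ≤ 2 * ρ * s := by
    have := mul_le_mul_of_nonneg_right hρhalf hs0
    linarith
  have h2s : 0 ≤ 2 * ρ * s := le_trans (by positivity) h2s'
  have hLf : ∀ f : V, ‖f‖ = 1 → ⟪f, ξ⟫ = 0 → ⟪f, e⟫ = 0 → ‖L f‖ ≤ 16 * T := by
    intro f hf hfξ hfe
    have hp := hpt f hf hfξ hfe c s hc.ge (by rw [hs2, hc]; ring)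
    have hm := hpt f hf hfξ hfe c (-s) hc.ge (by rw [neg_sq, hs2, hc]; ring)
    have h2 := norm_sub_le_of_le hm hp
    have h3 : (a₀ - (τ * L ξ + ρ * (c * L e + (-s : ℝ) * L f))) -
        (a₀ - (τ * L ξ + ρ * (c * L e + s * L f))) = ((2 * ρ * s : ℝ) : ℂ) * L f := by
      push_cast; ring
    rw [h3, norm_mul, Complex.norm_real, Real.norm_eq_abs, abs_of_nonneg h2s] at h2
    have h4 : ε ^ 2 / 8 ≤ 2 * ρ * s := h2s'
    have h5 := mul_le_mul_of_nonneg_right h4 (norm_nonneg (L f))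
    have h6 : ε ^ 2 * ‖L f‖ ≤ ε ^ 2 * (16 * T) := by linarith
    exact le_of_mul_le_mul_left h6 hε2'
  obtain ⟨g, hg, hgξ, hge⟩ := hV ξ e
  have h0 := hpt g hg hgξ hge 1 0 (by linarith) (by norm_num)
  have hS0 : 0 ≤ S := le_trans (norm_nonneg _) h0
  have hT0 : 0 ≤ T := by rw [hT]; positivity
  have hLe : ‖L e‖ ≤ 32 * T := by
    have hp := hpt g hg hgξ hge c s hc.ge (by rw [hs2, hc]; ring)
    have hm := hpt g hg hgξ hge c (-s) hc.ge (by rw [neg_sq, hs2, hc]; ring)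
    have h2 := norm_sub_le_of_le (norm_add_le_of_le hp hm) (norm_add_le_of_le h0 h0)
    have h3 : ((a₀ - (τ * L ξ + ρ * (c * L e + s * L g))) +
        (a₀ - (τ * L ξ + ρ * (c * L e + (-s : ℝ) * L g)))) -
        ((a₀ - (τ * L ξ + ρ * ((1 : ℝ) * L e + (0 : ℝ) * L g))) +
        (a₀ - (τ * L ξ + ρ * ((1 : ℝ) * L e + (0 : ℝ) * L g)))) =
        ((2 * ρ * (ε ^ 2 / 8) : ℝ) : ℂ) * L e := by
      rw [hc]; push_cast; ring
    rw [h3, norm_mul, Complex.norm_real, Real.norm_eq_abs, abs_of_nonneg (by positivity)] at h2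
    have h4 : ε ^ 2 / 8 ≤ 2 * ρ * (ε ^ 2 / 8) := by
      have := mul_le_mul_of_nonneg_right hρhalf hε2'.le
      linarith
    have h5 := mul_le_mul_of_nonneg_right h4 (norm_nonneg (L e))
    have h6 : ε ^ 2 * ‖L e‖ ≤ ε ^ 2 * (32 * T) := by linarith
    exact le_of_mul_le_mul_left h6 hε2'
  have hρ1 : ρ ≤ 1 := by
    by_contra hlt
    push Not at hlt
    have : 0 < (ρ + 1) * (ρ - 1) := mul_pos (by linarith) (by linarith)
    linarith [sq_nonneg τ]
  have hLξ : L ξ = -(τ * a₀) := by linear_combination hL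
  have ha0 : ‖a₀‖ ≤ S + 32 * T := by
    have h1 : ((1 + τ ^ 2 : ℝ) : ℂ) * a₀ =
        (a₀ - (τ * L ξ + ρ * ((1 : ℝ) * L e + (0 : ℝ) * L g))) + (ρ : ℂ) * L e := by
      rw [hLξ]; push_cast; ring
    have h2 : ‖(ρ : ℂ) * L e‖ ≤ 32 * T := by
      rw [norm_mul, Complex.norm_real, Real.norm_eq_abs, abs_of_nonneg (by linarith)]
      exact cone_aux_mul_le hρ1 (norm_nonneg _) hLe
    have h3 := norm_add_le_of_le h0 h2
    rw [← h1, norm_mul, Complex.norm_real, Real.norm_eq_abs, abs_of_nonneg (by positivity)] at h3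
    linarith [mul_nonneg (sq_nonneg τ) (norm_nonneg a₀)]
  have hLξn : ‖L ξ‖ ≤ S + 32 * T := by
    rw [hLξ, norm_neg, norm_mul, Complex.norm_real, Real.norm_eq_abs]
    have : |τ| ≤ 1 := by linarith
    exact cone_aux_mul_le this (norm_nonneg _) ha0
  rw [hgoal]
  refine ⟨by linarith, fun u hu => ?_⟩
  have hξe : ⟪ξ, e⟫ = 0 := by rw [real_inner_comm]; exact heξ
  obtain ⟨α, hα⟩ : ∃ α, ⟪u, ξ⟫ = α := ⟨_, rfl⟩
  obtain ⟨β, hβ⟩ : ∃ β, ⟪u, e⟫ = β := ⟨_, rfl⟩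
  have hα1 : |α| ≤ 1 := by
    have := abs_real_inner_le_norm u ξ
    rwa [hα, hu, hξ, mul_one] at this
  have hβ1 : |β| ≤ 1 := by
    have := abs_real_inner_le_norm u e
    rwa [hβ, hu, he, mul_one] at this
  obtain ⟨w, hw⟩ : ∃ w, w = u - α • ξ - β • e := ⟨_, rfl⟩
  have hwξ : ⟪w, ξ⟫ = 0 := by
    rw [hw]; simp only [inner_sub_left, real_inner_smul_left, hα, hξξ, heξ]; ring
  have hwe : ⟪w, e⟫ = 0 := by
    rw [hw]; simp only [inner_sub_left, real_inner_smul_left, hβ, hee, hξe]; ring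
  have hu' : u = α • ξ + β • e + w := by rw [hw]; abel
  have hwn : ‖w‖ ≤ 1 := by
    have h1 : ⟪w, w⟫ = ⟪u, w⟫ := by
      conv_rhs => rw [hu']
      simp only [inner_add_left, real_inner_smul_left]
      rw [real_inner_comm w ξ, real_inner_comm w e, hwξ, hwe]; ring
    have h2 := real_inner_le_norm u w
    rw [← h1, real_inner_self_eq_norm_sq, hu] at h2
    by_contra hlt
    push Not at hlt
    have : 0 < ‖w‖ * (‖w‖ - 1) := mul_pos (by linarith) (by linarith)
    linarith
  have hLw : ‖L w‖ ≤ 16 * T := by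
    by_cases hw0 : w = 0
    · rw [hw0, map_zero, norm_zero]; positivity
    · have h := hLf (‖w‖⁻¹ • w) (norm_smul_inv_norm (𝕜 := ℝ) hw0)
        (by rw [real_inner_smul_left, hwξ, mul_zero]) (by rw [real_inner_smul_left, hwe, mul_zero])
      have hwp : 0 < ‖w‖ := norm_pos_iff.mpr hw0
      have h2 : L w = (‖w‖ : ℂ) * L (‖w‖⁻¹ • w) := by
        rw [← Complex.real_smul, ← map_smul, smul_smul, mul_inv_cancel₀ hwp.ne', one_smul]
      rw [h2, norm_mul, Complex.norm_real, norm_norm]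
      exact cone_aux_mul_le hwn (norm_nonneg _) h
  have h1 : L u = (α : ℂ) * L ξ + β * L e + L w := by
    conv_lhs => rw [hu']
    simp only [map_add, map_smul, Complex.real_smul]
  have h2 : ‖(α : ℂ) * L ξ‖ ≤ S + 32 * T := by
    rw [norm_mul, Complex.norm_real, Real.norm_eq_abs]
    exact cone_aux_mul_le hα1 (norm_nonneg _) hLξn
  have h3 : ‖(β : ℂ) * L e‖ ≤ 32 * T := by
    rw [norm_mul, Complex.norm_real, Real.norm_eq_abs]
    exact cone_aux_mul_le hβ1 (norm_nonneg _) hLe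
  rw [h1]
  have h4 := norm_add_le_of_le (norm_add_le_of_le h2 h3) hLw
  linarith

end aux

/-- **Lemma 7 of the paper (linear-algebraic content)**: there is a nonempty open cone
`C₀ ⊆ {(τ,ξ) : ξ ≠ 0, |τ| < (ε/8)|ξ|}` and a constant `C > 0` such that for every
`(τ,ξ) ∈ C₀` and every divergence-free `a ∈ ℂ^{n+1}` (i.e. `τa₀ + Σ ξⱼaⱼ = 0`),
`max|aⱼ| ≤ C · sup{ |a₀ − ω·(a₁,…,aₙ)| : |ω| = 1, ω·ξ = τ, |ω − ω₀| < ε }`. -/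
theorem cone_stable_inversion_partial_data
    (n : ℕ) (hn : 3 ≤ n)
    (ω₀ : EuclideanSpace ℝ (Fin n)) (hω₀ : ‖ω₀‖ = 1)
    (ε : ℝ) (hε0 : 0 < ε) (hε1 : ε ≤ 1) :
    ∃ C₀ : Set (ℝ × EuclideanSpace ℝ (Fin n)),
      C₀.Nonempty ∧ IsOpen C₀ ∧
      (∀ p ∈ C₀, ∀ r : ℝ, 0 < r → (r * p.1, r • p.2) ∈ C₀) ∧
      C₀ ⊆ {p : ℝ × EuclideanSpace ℝ (Fin n) | p.2 ≠ 0 ∧ |p.1| < (ε / 8) * ‖p.2‖} ∧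
      ∃ C > 0,
        ∀ p ∈ C₀, ∀ a : Fin (n + 1) → ℂ,
          (p.1 : ℂ) * a 0 + ∑ j : Fin n, (p.2 j : ℂ) * a j.succ = 0 →
          ∀ j : Fin (n + 1),
            ‖a j‖ ≤ C * sSup ((fun ω : EuclideanSpace ℝ (Fin n) =>
                ‖a 0 - ∑ i : Fin n, (ω i : ℂ) * a i.succ‖) ''
              {ω : EuclideanSpace ℝ (Fin n) | ‖ω‖ = 1 ∧ ⟪ω, p.2⟫ = p.1 ∧ ‖ω - ω₀‖ < ε}) := by
  classical
  refine ⟨{p | |p.1| < (ε / 8) * ‖p.2‖ ∧ |⟪ω₀, p.2⟫| < (ε / 8) * ‖p.2‖}, ?_, ?_, ?_, ?_,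
    1 + 80 / ε ^ 2, by positivity, ?_⟩
  · obtain ⟨f, hf, hf0, -⟩ := cone_aux_exists_unit_orth n hn ω₀ ω₀
    refine ⟨(0, f), ?_, ?_⟩
    · simp only [hf, abs_zero]; linarith
    · have : ⟪ω₀, f⟫ = 0 := by rw [real_inner_comm]; exact hf0
      simp only [hf, this, abs_zero]; linarith
  · exact IsOpen.and (isOpen_lt (by fun_prop) (by fun_prop)) (isOpen_lt (by fun_prop) (by fun_prop))
  · rintro p ⟨h1, h2⟩ r hr
    have h3 : ‖r • p.2‖ = r * ‖p.2‖ := by rw [norm_smul, Real.norm_eq_abs, abs_of_pos hr]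
    refine ⟨?_, ?_⟩
    · simp only [h3, abs_mul, abs_of_pos hr]; nlinarith
    · simp only [h3, real_inner_smul_right, abs_mul, abs_of_pos hr]; nlinarith
  · rintro p ⟨h1, h2⟩
    refine ⟨?_, h1⟩
    intro h0
    rw [h0, norm_zero, mul_zero] at h1
    exact absurd h1 (not_lt.mpr (abs_nonneg _))
  · rintro p ⟨h1, h2⟩ a ha
    have hp : 0 < ‖p.2‖ := by
      have := lt_of_le_of_lt (abs_nonneg _) h1
      exact pos_of_mul_pos_right this (by positivity)
    let L : EuclideanSpace ℝ (Fin n) →ₗ[ℝ] ℂ :=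
      { toFun := fun v => ∑ i : Fin n, (v i : ℂ) * a i.succ
        map_add' := by
          intro x y
          simp [add_mul, Finset.sum_add_distrib]
        map_smul' := by
          intro r x
          simp [Finset.mul_sum, mul_assoc] }
    have hLdef : ∀ v, L v = ∑ i : Fin n, (v i : ℂ) * a i.succ := fun _ => rfl
    have hbdd : BddAbove ((fun ω : EuclideanSpace ℝ (Fin n) =>
                ‖a 0 - ∑ i : Fin n, (ω i : ℂ) * a i.succ‖) ''
              {ω : EuclideanSpace ℝ (Fin n) | ‖ω‖ = 1 ∧ ⟪ω, p.2⟫ = p.1 ∧ ‖ω - ω₀‖ < ε}) := by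
      refine ⟨‖a 0‖ + ∑ i : Fin n, ‖a i.succ‖, ?_⟩
      rintro _ ⟨ω, ⟨hω, -, -⟩, rfl⟩
      refine norm_sub_le_of_le le_rfl (norm_sum_le_of_le _ fun i _ => ?_)
      rw [norm_mul, Complex.norm_real]
      have := PiLp.norm_apply_le ω i
      rw [hω] at this
      nlinarith [norm_nonneg (a i.succ)]
    have key := cone_aux_main (cone_aux_exists_unit_orth n hn) L (a 0) ω₀ (‖p.2‖⁻¹ • p.2) ε
      (‖p.2‖⁻¹ * p.1) _ hω₀ hε0 hε1
      (norm_smul_inv_norm (𝕜 := ℝ) (norm_pos_iff.mp hp))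
      (by rw [abs_mul, abs_of_pos (inv_pos.mpr hp), inv_mul_lt_iff₀ hp]; linarith)
      (by rw [real_inner_smul_right, abs_mul, abs_of_pos (inv_pos.mpr hp), inv_mul_lt_iff₀ hp]
          linarith)
      (by rw [map_smul, Complex.real_smul, hLdef]
          push_cast
          linear_combination ((‖p.2‖ : ℂ)⁻¹) * ha)
      (fun ω w1 w2 w3 => le_csSup hbdd ⟨ω, ⟨w1, by
        rw [real_inner_smul_right] at w2
        exact mul_left_cancel₀ (inv_pos.mpr hp).ne' w2, w3⟩, rfl⟩)
    intro j
    refine Fin.cases key.1 (fun i => ?_) j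
    have h := key.2 (EuclideanSpace.single i (1 : ℝ)) (by simp)
    have hLi : L (EuclideanSpace.single i (1 : ℝ)) = a i.succ := by
      rw [hLdef, Finset.sum_eq_single i]
      · simp
      · intro b _ hb
        simp [hb]
      · simp
    rwa [hLi] at h
end
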